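/- arXiv:1210.7084 — 4 statements merged into one kernel-verified Lean document; each statement's English description precedes it below -/
import Mathlib

section
/- Let t > 0, p ∈ ℝ, k ≥ 0 an integer, and define φ_k(x,t,p) = ∫_p^∞ e^{−(x−y)²/t} (d^{2k}/dy^{2k}) e^{−y²} dy. Then for every x ∈ ℝ, φ_k(x,t,p) = e^{−x²/(1+t)} [ erfc(F(t,x,p)) H_{2k}(x/√(1+t)) · √(πt)/(2(1+t)^{k+1/2}) + e^{−F(t,x,p)²} Σ_{ℓ=1}^{2k} ((−1)^ℓ / t^{(ℓ−1)/2}) ( C(2k,ℓ) H_{2k−ℓ}(x/√(1+t)) H_{ℓ−1}(F(t,x,p)) / (1+t)^{k+1/2} − H_{ℓ−1}((p−x)/√t) H_{2k−ℓ}(p) ) ]. -/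
open MeasureTheory Real Finset

/-- Physicists' Hermite polynomial `H_k(x)`. -/
noncomputable def herm (k : ℕ) (x : ℝ) : ℝ :=
  (-1 : ℝ) ^ k * Real.exp (x ^ 2) * iteratedDeriv k (fun y => Real.exp (-y ^ 2)) x

/-- Complementary error function. -/
noncomputable def erfc (z : ℝ) : ℝ :=
  (2 / Real.sqrt Real.pi) * ∫ s in Set.Ioi z, Real.exp (-s ^ 2)

/-- The function `F(t,x,a) = √((1+t)/t)·(a − x/(1+t))`. -/
noncomputable def Fn (t x a : ℝ) : ℝ :=
  Real.sqrt ((1 + t) / t) * (a - x / (1 + t))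

/-- The Gaussian `e^{-y²}`. -/
noncomputable def gauss (y : ℝ) : ℝ := Real.exp (-y ^ 2)

/-- The Gaussian tail `∫_z^∞ e^{-s²} ds`. -/
noncomputable def gaussTail (z : ℝ) : ℝ := ∫ s in Set.Ioi z, gauss s

lemma contDiff_gauss {n : WithTop ℕ∞} : ContDiff ℝ n gauss := by
  unfold gauss
  fun_prop

lemma herm_eq (k : ℕ) (x : ℝ) :
    herm k x = (-1) ^ k * (gauss x)⁻¹ * iteratedDeriv k gauss x := by
  rw [gauss, ← Real.exp_neg, neg_neg]
  rfl

lemma hasDerivAt_iteratedDeriv_gauss (n : ℕ) (x : ℝ) :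
    HasDerivAt (iteratedDeriv n gauss) (iteratedDeriv (n + 1) gauss x) x := by
  rw [iteratedDeriv_succ]
  exact ((contDiff_gauss (n := (n + 1 : ℕ))).differentiable_iteratedDeriv n
    (by exact_mod_cast Nat.lt_succ_self n) x).hasDerivAt

lemma continuous_iteratedDeriv_gauss (n : ℕ) : Continuous (iteratedDeriv n gauss) :=
  continuous_iff_continuousAt.2 fun x => (hasDerivAt_iteratedDeriv_gauss n x).continuousAt

lemma exists_polynomial_iteratedDeriv_gauss (n : ℕ) :
    ∃ P : Polynomial ℝ, ∀ x, iteratedDeriv n gauss x = P.eval x * gauss x := by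
  induction n with
  | zero => exact ⟨1, fun x => by simp⟩
  | succ n ih =>
    obtain ⟨P, hP⟩ := ih
    refine ⟨P.derivative - 2 * Polynomial.X * P, fun x => ?_⟩
    have hg : HasDerivAt gauss (Real.exp (-x ^ 2) * -(2 * x)) x := by
      have := ((hasDerivAt_pow 2 x).neg).exp
      simpa [gauss] using! this
    rw [iteratedDeriv_succ, funext hP, ((P.hasDerivAt x).fun_mul hg).deriv]
    simp [gauss]
    ring

lemma iteratedDeriv_gauss_isLittleO (n : ℕ) :
    iteratedDeriv n gauss =o[Filter.atTop] fun x => Real.exp (-1 * x) := by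
  obtain ⟨P, hP⟩ := exists_polynomial_iteratedDeriv_gauss n
  rw [Asymptotics.isLittleO_iff_tendsto fun x hx => absurd hx (Real.exp_ne_zero _)]
  have h1 : Filter.Tendsto (fun x => P.eval x / Real.exp x) Filter.atTop (nhds 0) :=
    P.tendsto_div_exp_atTop
  refine squeeze_zero_norm' ?_ (by simpa using h1.norm)
  filter_upwards [Filter.eventually_ge_atTop (2 : ℝ)] with x hx
  rw [hP, gauss, div_eq_mul_inv, mul_assoc, ← Real.exp_neg, ← Real.exp_add,
    div_eq_mul_inv, ← Real.exp_neg, norm_mul, Real.norm_of_nonneg (Real.exp_nonneg _),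
    Real.norm_eq_abs]
  gcongr
  nlinarith

lemma tendsto_iteratedDeriv_gauss (n : ℕ) :
    Filter.Tendsto (iteratedDeriv n gauss) Filter.atTop (nhds 0) := by
  refine (iteratedDeriv_gauss_isLittleO n).isBigO.trans_tendsto ?_
  simpa using Real.tendsto_exp_neg_atTop_nhds_zero

lemma integrable_gauss : Integrable gauss := by
  simpa [gauss] using! integrable_exp_neg_mul_sq (b := 1) one_pos

lemma gaussTail_eq (z : ℝ) : gaussTail z = (∫ s, gauss s) - ∫ s in Set.Iic z, gauss s := by
  rw [gaussTail, ← intervalIntegral.integral_Iic_add_Ioi (b := z) integrable_gauss.integrableOn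
    integrable_gauss.integrableOn]
  ring

lemma hasDerivAt_gaussTail (z : ℝ) : HasDerivAt gaussTail (-gauss z) z := by
  have hc : Continuous gauss := (contDiff_gauss (n := 0)).continuous
  have h : gaussTail = fun u => gaussTail 0 - ∫ s in (0 : ℝ)..u, gauss s := by
    funext u
    rw [gaussTail_eq, gaussTail_eq,
      ← intervalIntegral.integral_Iic_sub_Iic integrable_gauss.integrableOn
        integrable_gauss.integrableOn]
    ring
  rw [h]
  exact (intervalIntegral.integral_hasDerivAt_right (hc.intervalIntegrable _ _)
    (hc.stronglyMeasurableAtFilter _ _) hc.continuousAt).const_sub _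

lemma tendsto_gaussTail : Filter.Tendsto gaussTail Filter.atTop (nhds 0) := by
  have h : Filter.Tendsto (fun u => gaussTail 0 - ∫ s in (0 : ℝ)..u, gauss s)
      Filter.atTop (nhds (gaussTail 0 - gaussTail 0)) :=
    (intervalIntegral_tendsto_integral_Ioi 0 integrable_gauss.integrableOn
      Filter.tendsto_id).const_sub _
  rw [sub_self] at h
  refine h.congr fun u => ?_
  rw [gaussTail_eq, gaussTail_eq,
    ← intervalIntegral.integral_Iic_sub_Iic integrable_gauss.integrableOn
      integrable_gauss.integrableOn]
  ring

lemma iteratedDeriv_comp_affine (f : ℝ → ℝ) (hf : ∀ n : ℕ, ContDiff ℝ n f) (n : ℕ) (a b u : ℝ) :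
    iteratedDeriv n (fun v => f (a + b * v)) u = b ^ n * iteratedDeriv n f (a + b * u) := by
  have h := iteratedDeriv_comp_const_mul (n := n) (f := fun v => f (a + v))
    ((hf n).comp (contDiff_const.add contDiff_id)) b
  rw [h]
  simp [iteratedDeriv_comp_const_add]

lemma gauss_mul_gauss {s r : ℝ} (hs : s ≠ 0) (hr : r ≠ 0) (h : r ^ 2 = 1 + s ^ 2) (x y : ℝ) :
    gauss (x / r) * gauss (r / s * (y - x / r ^ 2)) = gauss ((y - x) / s) * gauss y := by
  simp only [gauss, ← Real.exp_add]
  congr 1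
  field_simp
  simp only [h]
  ring

/-- Addition formula for derivatives of the Gaussian. -/
lemma sum_iteratedDeriv_gauss {s r : ℝ} (hs : s ≠ 0) (hr : r ≠ 0) (h : r ^ 2 = 1 + s ^ 2)
    (n : ℕ) (x y : ℝ) :
    ∑ l ∈ range (n + 1), (n.choose l : ℝ) *
        ((-1 / (r * s)) ^ l * iteratedDeriv l gauss (r / s * (y - x / r ^ 2))) *
        ((1 / r) ^ (n - l) * iteratedDeriv (n - l) gauss (x / r)) =
      (-1 / s) ^ n * iteratedDeriv n gauss ((y - x) / s) * gauss y := by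
  have hg : ∀ n : ℕ, ContDiff ℝ n gauss := fun n => contDiff_gauss
  have key : (fun u => gauss (r / s * (y - x / r ^ 2) + -1 / (r * s) * u)) *
      (fun u => gauss (x / r + 1 / r * u)) =
      fun u => gauss ((y - x) / s + -1 / s * u) * gauss y := by
    funext u
    have := gauss_mul_gauss hs hr h (x + u) y
    rw [Pi.mul_apply, mul_comm]
    convert this using 3 <;> field_simp <;> ring
  have hL := iteratedDeriv_mul (n := n) (x := (0 : ℝ))
    (f := fun u => gauss (r / s * (y - x / r ^ 2) + -1 / (r * s) * u))
    (g := fun u => gauss (x / r + 1 / r * u))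
    ((hg n).comp (by fun_prop)).contDiffAt ((hg n).comp (by fun_prop)).contDiffAt
  rw [key, iteratedDeriv_mul_const_field] at hL
  simp only [iteratedDeriv_comp_affine gauss hg, mul_zero, add_zero] at hL
  exact hL.symm

/-- Minus an antiderivative of `y ↦ e^{-((y-x)/s)²} (d/dy)^n e^{-y²}`, vanishing at infinity. -/
noncomputable def gaussPrimitive (s r x : ℝ) (n : ℕ) (y : ℝ) : ℝ :=
  s / r * ((1 / r) ^ n * iteratedDeriv n gauss (x / r) * gaussTail (r / s * (y - x / r ^ 2)))
    - s / r * ∑ j ∈ range n, (n.choose (j + 1) : ℝ) *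
        ((-1 / (r * s)) ^ (j + 1) * iteratedDeriv j gauss (r / s * (y - x / r ^ 2))) *
        ((1 / r) ^ (n - (j + 1)) * iteratedDeriv (n - (j + 1)) gauss (x / r))
    - ∑ j ∈ range n, (-1 / s) ^ j * (iteratedDeriv j gauss ((y - x) / s) *
        iteratedDeriv (n - (j + 1)) gauss y)

lemma hasDerivAt_gaussPrimitive {s r : ℝ} (hs : s ≠ 0) (hr : r ≠ 0) (h : r ^ 2 = 1 + s ^ 2)
    (x : ℝ) (n : ℕ) (y : ℝ) :
    HasDerivAt (gaussPrimitive s r x n)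
      (-(gauss ((y - x) / s) * iteratedDeriv n gauss y)) y := by
  have hF : HasDerivAt (fun y => r / s * (y - x / r ^ 2)) (r / s) y := by
    simpa using ((hasDerivAt_id y).sub_const (x / r ^ 2)).const_mul (r / s)
  have hq : HasDerivAt (fun y => (y - x) / s) (1 / s) y := by
    simpa using ((hasDerivAt_id y).sub_const x).div_const s
  have hd := ((((hasDerivAt_gaussTail _).comp y hF).const_mul
      ((1 / r) ^ n * iteratedDeriv n gauss (x / r))).const_mul (s / r)).sub
      ((HasDerivAt.fun_sum fun j (_ : j ∈ range n) =>
        ((((hasDerivAt_iteratedDeriv_gauss j _).comp y hF).const_mul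
          ((-1 / (r * s)) ^ (j + 1))).const_mul (n.choose (j + 1) : ℝ)).mul_const
          ((1 / r) ^ (n - (j + 1)) * iteratedDeriv (n - (j + 1)) gauss (x / r))).const_mul (s / r))
  have hd' := hd.sub (HasDerivAt.fun_sum fun j (_ : j ∈ range n) =>
      (((hasDerivAt_iteratedDeriv_gauss j _).comp y hq).mul
        (hasDerivAt_iteratedDeriv_gauss (n - (j + 1)) y)).const_mul ((-1 / s) ^ j))
  refine hd'.congr_deriv ?_
  have hadd := sum_iteratedDeriv_gauss hs hr h n x y
  rw [sum_range_succ'] at hadd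
  have htel : ∑ j ∈ range n, (-1 / s) ^ j *
      (iteratedDeriv (j + 1) gauss ((y - x) / s) * (1 / s) * iteratedDeriv (n - (j + 1)) gauss y +
        iteratedDeriv j gauss ((y - x) / s) * iteratedDeriv (n - (j + 1) + 1) gauss y) =
      gauss ((y - x) / s) * iteratedDeriv n gauss y -
        (-1 / s) ^ n * iteratedDeriv n gauss ((y - x) / s) * gauss y := by
    have := sum_range_sub' (fun l => (-1 / s) ^ l * (iteratedDeriv l gauss ((y - x) / s) *
      iteratedDeriv (n - l) gauss y)) n
    simp only [pow_zero, one_mul, iteratedDeriv_zero, Nat.sub_zero, Nat.sub_self] at this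
    rw [mul_assoc ((-1 / s) ^ n), ← this]
    refine sum_congr rfl fun j hj => ?_
    have hj' : n - (j + 1) + 1 = n - j := by have := mem_range.1 hj; omega
    rw [hj', pow_succ]
    ring
  have hsum : ∑ j ∈ range n, (n.choose (j + 1) : ℝ) * ((-1 / (r * s)) ^ (j + 1) *
        (iteratedDeriv (j + 1) gauss (r / s * (y - x / r ^ 2)) * (r / s))) *
        ((1 / r) ^ (n - (j + 1)) * iteratedDeriv (n - (j + 1)) gauss (x / r)) =
      r / s * ∑ j ∈ range n, (n.choose (j + 1) : ℝ) * ((-1 / (r * s)) ^ (j + 1) *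
        iteratedDeriv (j + 1) gauss (r / s * (y - x / r ^ 2))) *
        ((1 / r) ^ (n - (j + 1)) * iteratedDeriv (n - (j + 1)) gauss (x / r)) := by
    rw [mul_sum]
    exact sum_congr rfl fun j _ => by ring
  have hrs : s / r * (r / s) = 1 := by field_simp
  simp only [Nat.choose_zero_right, Nat.cast_one, pow_zero, one_mul, iteratedDeriv_zero,
    Nat.sub_zero] at hadd
  simp only [Function.comp_apply]
  rw [htel, hsum]
  linear_combination (-1 : ℝ) * hadd - hrs * (((1 / r) ^ n * iteratedDeriv n gauss (x / r)) *
    gauss (r / s * (y - x / r ^ 2)) + ∑ j ∈ range n, (n.choose (j + 1) : ℝ) *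
      ((-1 / (r * s)) ^ (j + 1) * iteratedDeriv (j + 1) gauss (r / s * (y - x / r ^ 2))) *
      ((1 / r) ^ (n - (j + 1)) * iteratedDeriv (n - (j + 1)) gauss (x / r)))

lemma tendsto_gaussPrimitive {s r : ℝ} (hs : 0 < s) (hr : 0 < r) (x : ℝ) (n : ℕ) :
    Filter.Tendsto (gaussPrimitive s r x n) Filter.atTop (nhds 0) := by
  have hF : Filter.Tendsto (fun y => r / s * (y - x / r ^ 2)) Filter.atTop Filter.atTop :=
    (Filter.tendsto_atTop_add_const_right _ (-(x / r ^ 2)) Filter.tendsto_id).const_mul_atTop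
      (div_pos hr hs)
  have hq : Filter.Tendsto (fun y => (y - x) / s) Filter.atTop Filter.atTop :=
    (Filter.tendsto_atTop_add_const_right _ (-x) Filter.tendsto_id).atTop_div_const hs
  have h := ((((tendsto_gaussTail.comp hF).const_mul
      ((1 / r) ^ n * iteratedDeriv n gauss (x / r))).const_mul (s / r)).sub
      ((tendsto_finsetSum (range n) fun j _ =>
        ((((tendsto_iteratedDeriv_gauss j).comp hF).const_mul
          ((-1 / (r * s)) ^ (j + 1))).const_mul (n.choose (j + 1) : ℝ)).mul_const
          ((1 / r) ^ (n - (j + 1)) * iteratedDeriv (n - (j + 1)) gauss (x / r))).const_mul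
            (s / r))).sub
      (tendsto_finsetSum (range n) fun j _ =>
        (((tendsto_iteratedDeriv_gauss j).comp hq).mul
          (tendsto_iteratedDeriv_gauss (n - (j + 1)))).const_mul ((-1 / s) ^ j))
  simp only [mul_zero, zero_mul, sum_const_zero, sub_zero] at h
  exact h

lemma integral_gauss_mul_iteratedDeriv_gauss {s r : ℝ} (hs : 0 < s) (hr : 0 < r)
    (h : r ^ 2 = 1 + s ^ 2) (x : ℝ) (n : ℕ) (p : ℝ) :
    ∫ y in Set.Ioi p, gauss ((y - x) / s) * iteratedDeriv n gauss y =
      gaussPrimitive s r x n p := by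
  have hc : Continuous fun y => gauss ((y - x) / s) * iteratedDeriv n gauss y :=
    ((contDiff_gauss (n := 0)).continuous.comp (by fun_prop)).mul
      (continuous_iteratedDeriv_gauss n)
  have hint : IntegrableOn (fun y => gauss ((y - x) / s) * iteratedDeriv n gauss y)
      (Set.Ioi p) := by
    refine integrable_of_isBigO_exp_neg one_pos hc.continuousOn ?_
    refine Asymptotics.IsBigO.trans (Asymptotics.isBigO_of_le _ fun y => ?_)
      (iteratedDeriv_gauss_isLittleO n).isBigO
    rw [norm_mul]
    refine mul_le_of_le_one_left (norm_nonneg _) ?_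
    rw [gauss, Real.norm_of_nonneg (Real.exp_nonneg _)]
    exact Real.exp_le_one_iff.2 (neg_nonpos.2 (sq_nonneg _))
  have hd := fun y => hasDerivAt_gaussPrimitive hs.ne' hr.ne' h x n y
  have := integral_Ioi_of_hasDerivAt_of_tendsto (hd p).continuousAt.continuousWithinAt
    (fun y _ => hd y) hint.neg (tendsto_gaussPrimitive hs hr x n)
  rw [integral_neg] at this
  linarith

/-- explicit formula for `φ_k(x,t,p)`. -/
theorem stmt12 (t : ℝ) (ht : 0 < t) (p : ℝ) (k : ℕ) (x : ℝ) :
    (∫ y in Set.Ioi p,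
        Real.exp (-(x - y) ^ 2 / t) * iteratedDeriv (2 * k) (fun y => Real.exp (-y ^ 2)) y)
    = Real.exp (-x ^ 2 / (1 + t)) *
        (erfc (Fn t x p) * herm (2 * k) (x / Real.sqrt (1 + t)) *
            (Real.sqrt (Real.pi * t) / (2 * (1 + t) ^ ((k : ℝ) + 1 / 2)))
          + Real.exp (-(Fn t x p) ^ 2) *
              ∑ l ∈ Finset.Icc 1 (2 * k),
                ((-1 : ℝ) ^ l / t ^ (((l : ℝ) - 1) / 2)) *
                  (((2 * k).choose l : ℝ) * herm (2 * k - l) (x / Real.sqrt (1 + t)) *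
                      herm (l - 1) (Fn t x p) / (1 + t) ^ ((k : ℝ) + 1 / 2)
                    - herm (l - 1) ((p - x) / Real.sqrt t) * herm (2 * k - l) p)) := by
  obtain ⟨s, hs, rfl⟩ : ∃ s : ℝ, 0 < s ∧ t = s ^ 2 :=
    ⟨√t, Real.sqrt_pos.2 ht, (Real.sq_sqrt ht.le).symm⟩
  obtain ⟨r, hr, hrs⟩ : ∃ r : ℝ, 0 < r ∧ 1 + s ^ 2 = r ^ 2 :=
    ⟨√(1 + s ^ 2), Real.sqrt_pos.2 (by positivity), (Real.sq_sqrt (by positivity)).symm⟩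
  have hF : Fn (s ^ 2) x p = r / s * (p - x / r ^ 2) := by
    rw [Fn, hrs, ← div_pow, Real.sqrt_sq (by positivity)]
  have hpow : (r ^ 2) ^ ((k : ℝ) + 1 / 2) = r ^ (2 * k + 1) := by
    rw [← Real.rpow_natCast, ← Real.rpow_natCast, ← Real.rpow_mul hr.le]
    congr 1
    push_cast
    ring
  have hspow (j : ℕ) : (s ^ 2) ^ ((((1 + j : ℕ) : ℝ) - 1) / 2) = s ^ j := by
    rw [← Real.rpow_natCast, ← Real.rpow_natCast, ← Real.rpow_mul hs.le]
    congr 1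
    push_cast
    ring
  have hexp : Real.exp (-x ^ 2 / r ^ 2) = gauss (x / r) := by
    rw [gauss, div_pow, neg_div]
  have hint : ∀ y, Real.exp (-(x - y) ^ 2 / s ^ 2) = gauss ((y - x) / s) := fun y => by
    rw [gauss, div_pow, neg_div, sub_sq_comm]
  have hgauss := gauss_mul_gauss hs.ne' hr.ne' hrs.symm x p
  have hpos (z : ℝ) : gauss z ≠ 0 := Real.exp_ne_zero _
  have herfc (z : ℝ) : erfc z = 2 / √π * gaussTail z := rfl
  change ∫ y in Set.Ioi p, Real.exp (-(x - y) ^ 2 / s ^ 2) * iteratedDeriv (2 * k) gauss y = _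
  simp only [hint]
  rw [integral_gauss_mul_iteratedDeriv_gauss hs hr hrs.symm, hF, hrs, hpow, hexp,
    Real.sqrt_sq hr.le, Real.sqrt_sq hs.le, Real.sqrt_mul Real.pi_pos.le, Real.sqrt_sq hs.le,
    herfc, herm_eq (2 * k), ← Ico_succ_right_eq_Icc, sum_Ico_eq_sum_range]
  change _ = gauss (x / r) * (_ + gauss (r / s * (p - x / r ^ 2)) * _)
  simp only [hspow, herm_eq]
  rw [gaussPrimitive, sub_sub, sub_eq_add_neg, mul_add]
  generalize r / s * (p - x / r ^ 2) = F at *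
  generalize (p - x) / s = q at *
  have hπ : √π ≠ 0 := (Real.sqrt_pos.2 Real.pi_pos).ne'
  congr 1
  · rw [pow_mul (-1 : ℝ)]
    generalize gaussTail F = a, iteratedDeriv (2 * k) gauss (x / r) = b
    have := hpos (x / r)
    generalize gauss (x / r) = c at *
    rw [div_pow, one_pow, neg_one_sq, one_pow]
    field_simp
    ring
  · rw [← mul_assoc, mul_sum, mul_sum, ← sum_add_distrib, ← sum_neg_distrib]
    refine sum_congr (by simp) fun j hj => ?_
    obtain ⟨m, hm⟩ : ∃ m, 2 * k = j + 1 + m :=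
      Nat.exists_eq_add_of_le (mem_range.1 hj)
    have hsign : (-1 : ℝ) ^ j * (-1) ^ m = -1 := by
      have : (-1 : ℝ) ^ (j + 1 + m) = 1 := by rw [← hm, pow_mul]; simp
      rw [pow_add, pow_succ] at this
      linarith
    have hsq : (-1 : ℝ) ^ j * (-1) ^ j = 1 := by rw [← mul_pow]; simp
    rw [add_comm 1 j, hm, Nat.add_sub_cancel_left, Nat.add_sub_cancel, mul_sub, mul_sub, neg_add,
      sub_eq_add_neg]
    have hX := hpos (x / r)
    have hF' := hpos F
    have hq := hpos q
    have hp := hpos p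
    congr 1
    · generalize gauss (x / r) = c, gauss F = d, iteratedDeriv m gauss (x / r) = a,
        iteratedDeriv j gauss F = b at *
      rw [div_pow, div_pow, one_pow, mul_pow]
      field_simp
      linear_combination (-(r * ((j + 1 + m).choose (j + 1) : ℝ) * r ^ (j + 1) * s ^ (j + 1) * b *
        r ^ m * a)) * hsign
    · rw [hgauss]
      generalize gauss q = c, gauss p = d, iteratedDeriv m gauss p = a,
        iteratedDeriv j gauss q = b at *
      rw [div_pow]
      field_simp
      linear_combination (-(b * a)) * hsign
end

section
/- For all real a > −1 and b > −1, every integer j ≥ 0, and all x, y ∈ ℝ, the Laguerre addition formula L_j^{(a+b+1)}(x+y) = Σ_{l=0}^{j} L_l^{(a)}(x) L_{j−l}^{(b)}(y) holds. -/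
open MeasureTheory Real Finset

/-- Generalized Laguerre polynomial `L_k^{(γ)}(y)`. -/
noncomputable def lag (k : ℕ) (γ : ℝ) (y : ℝ) : ℝ :=
  ∑ i ∈ Finset.range (k + 1),
    (-1 : ℝ) ^ i * (Real.Gamma ((k : ℝ) + γ + 1) /
      (Real.Gamma ((i : ℝ) + γ + 1) * ((k - i).factorial : ℝ))) * y ^ i / (i.factorial : ℝ)

/-- The Chu–Vandermonde identity for rising factorials. -/
theorem ascPochhammer_eval_add {R : Type*} [CommRing R] (r s : R) (k : ℕ) :
    (ascPochhammer R k).eval (r + s) = ∑ ij ∈ antidiagonal k,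
      (Nat.choose k ij.1 : R) *
        ((ascPochhammer R ij.1).eval r * (ascPochhammer R ij.2).eval s) := by
  induction k with
  | zero => simp
  | succ k ih =>
    rw [ascPochhammer_succ_eval, sum_antidiagonal_choose_succ_mul
      fun i j => (ascPochhammer R i).eval r * (ascPochhammer R j).eval s,
      ← sum_add_distrib, ih, sum_mul]
    refine sum_congr rfl fun ij hij => ?_
    have hk : ij.1 + ij.2 = k := mem_antidiagonal.mp hij
    have hchoose : k.choose ij.2 = k.choose ij.1 := (Nat.choose_symm_of_eq_add hk.symm).symm
    rw [ascPochhammer_succ_eval, ascPochhammer_succ_eval, hchoose, ← hk]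
    push_cast
    ring

/-- The Chu–Vandermonde identity for rising factorials divided by factorials. -/
theorem ascPochhammer_eval_add_div_factorial {K : Type*} [Field K] [CharZero K] (r s : K) (k : ℕ) :
    (ascPochhammer K k).eval (r + s) / (k.factorial : K) = ∑ ij ∈ antidiagonal k,
      (ascPochhammer K ij.1).eval r / (ij.1.factorial : K) *
        ((ascPochhammer K ij.2).eval s / (ij.2.factorial : K)) := by
  rw [ascPochhammer_eval_add, sum_div]
  refine sum_congr rfl fun ij hij => ?_
  obtain rfl : ij.1 + ij.2 = k := mem_antidiagonal.mp hij
  have h1 : (ij.1.factorial : K) ≠ 0 := mod_cast ij.1.factorial_ne_zero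
  have h2 : (ij.2.factorial : K) ≠ 0 := mod_cast ij.2.factorial_ne_zero
  have h3 : ((ij.1 + ij.2).factorial : K) ≠ 0 := mod_cast (ij.1 + ij.2).factorial_ne_zero
  rw [Nat.cast_add_choose]
  field_simp

/-- The binomial theorem in terms of divided powers. -/
theorem add_pow_div_factorial {K : Type*} [Field K] [CharZero K] (x y : K) (n : ℕ) :
    (x + y) ^ n / (n.factorial : K) = ∑ ij ∈ antidiagonal n,
      x ^ ij.1 / (ij.1.factorial : K) * (y ^ ij.2 / (ij.2.factorial : K)) := by
  rw [(Commute.all x y).add_pow', sum_div]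
  refine sum_congr rfl fun ij hij => ?_
  obtain rfl : ij.1 + ij.2 = n := mem_antidiagonal.mp hij
  have h1 : (ij.1.factorial : K) ≠ 0 := mod_cast ij.1.factorial_ne_zero
  have h2 : (ij.2.factorial : K) ≠ 0 := mod_cast ij.2.factorial_ne_zero
  have h3 : ((ij.1 + ij.2).factorial : K) ≠ 0 := mod_cast (ij.1 + ij.2).factorial_ne_zero
  rw [nsmul_eq_mul, Nat.cast_add_choose]
  field_simp

theorem Real.Gamma_add_natCast {s : ℝ} (hs : 0 < s) (n : ℕ) :
    Gamma (s + n) = (ascPochhammer ℝ n).eval s * Gamma s := by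
  induction n with
  | zero => simp
  | succ n ih =>
    have h : s + n ≠ 0 := by positivity
    rw [ascPochhammer_succ_eval, Nat.cast_succ, ← add_assoc, Gamma_add_one h, ih]
    ring

/-- Laguerre polynomials in terms of rising factorials. -/
theorem lag_eq_sum_antidiagonal {γ : ℝ} (hγ : -1 < γ) (k : ℕ) (y : ℝ) :
    lag k γ y = ∑ ip ∈ antidiagonal k,
      (-y) ^ ip.1 / (ip.1.factorial : ℝ) *
        ((ascPochhammer ℝ ip.2).eval (ip.1 + γ + 1) / (ip.2.factorial : ℝ)) := by
  rw [Nat.sum_antidiagonal_eq_sum_range_succ_mk, lag]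
  refine sum_congr rfl fun i hi => ?_
  obtain ⟨p, rfl⟩ := Nat.exists_eq_add_of_le (Nat.lt_succ_iff.mp (mem_range.mp hi))
  have hpos : 0 < (i : ℝ) + γ + 1 := by
    have : (0 : ℝ) ≤ i := i.cast_nonneg
    linarith
  have hG : Gamma ((i : ℝ) + γ + 1) ≠ 0 := (Gamma_pos_of_pos hpos).ne'
  have harg : ((i + p : ℕ) : ℝ) + γ + 1 = (i + γ + 1) + p := by push_cast; ring
  rw [Nat.add_sub_cancel_left, harg, Gamma_add_natCast hpos, neg_pow y]
  field_simp

/-- Transposing a two-by-two array of natural numbers with given total. -/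
theorem Finset.sum_antidiagonal_transpose {M : Type*} [AddCommMonoid M]
    (F : ℕ → ℕ → ℕ → ℕ → M) (n : ℕ) :
    ∑ u ∈ antidiagonal n, ∑ v ∈ antidiagonal u.1, ∑ w ∈ antidiagonal u.2,
        F v.1 v.2 w.1 w.2 =
      ∑ u ∈ antidiagonal n, ∑ v ∈ antidiagonal u.1, ∑ w ∈ antidiagonal u.2,
        F v.1 w.1 v.2 w.2 := by
  simp only [← sum_product']
  rw [sum_sigma', sum_sigma']
  refine sum_nbij'
    (fun t => ⟨(t.2.1.1 + t.2.2.1, t.2.1.2 + t.2.2.2),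
      ((t.2.1.1, t.2.2.1), (t.2.1.2, t.2.2.2))⟩)
    (fun t => ⟨(t.2.1.1 + t.2.2.1, t.2.1.2 + t.2.2.2),
      ((t.2.1.1, t.2.2.1), (t.2.1.2, t.2.2.2))⟩) ?_ ?_ ?_ ?_ ?_
  · rintro ⟨⟨a, b⟩, ⟨c, d⟩, ⟨e, f⟩⟩
    simp only [mem_sigma, mem_product, HasAntidiagonal.mem_antidiagonal, and_true]
    omega
  · rintro ⟨⟨a, b⟩, ⟨c, d⟩, ⟨e, f⟩⟩
    simp only [mem_sigma, mem_product, HasAntidiagonal.mem_antidiagonal, and_true]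
    omega
  · rintro ⟨⟨a, b⟩, ⟨c, d⟩, ⟨e, f⟩⟩
    simp only [mem_sigma, mem_product, HasAntidiagonal.mem_antidiagonal]
    rintro ⟨-, rfl, rfl⟩
    rfl
  · rintro ⟨⟨a, b⟩, ⟨c, d⟩, ⟨e, f⟩⟩
    simp only [mem_sigma, mem_product, HasAntidiagonal.mem_antidiagonal]
    rintro ⟨-, rfl, rfl⟩
    rfl
  · intros
    rfl

/-- Laguerre addition formula. -/
theorem stmt14 (a b : ℝ) (ha : -1 < a) (hb : -1 < b) (j : ℕ) (x y : ℝ) :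
    lag j (a + b + 1) (x + y)
    = ∑ l ∈ Finset.range (j + 1), lag l a x * lag (j - l) b y := by
  rw [← Nat.sum_antidiagonal_eq_sum_range_succ (fun l m => lag l a x * lag m b y),
    lag_eq_sum_antidiagonal (by linarith)]
  simp only [lag_eq_sum_antidiagonal ha, lag_eq_sum_antidiagonal hb, sum_mul_sum]
  rw [sum_antidiagonal_transpose fun i p i' q =>
    (-x) ^ i / (i.factorial : ℝ) *
        ((ascPochhammer ℝ p).eval (i + a + 1) / (p.factorial : ℝ)) *
      ((-y) ^ i' / (i'.factorial : ℝ) *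
        ((ascPochhammer ℝ q).eval (i' + b + 1) / (q.factorial : ℝ)))]
  refine sum_congr rfl fun u _ => ?_
  rw [neg_add, add_pow_div_factorial, sum_mul]
  refine sum_congr rfl fun v hv => ?_
  have harg : (u.1 : ℝ) + (a + b + 1) + 1 = (v.1 + a + 1) + (v.2 + b + 1) := by
    rw [← mem_antidiagonal.mp hv]
    push_cast
    ring
  rw [harg, ascPochhammer_eval_add_div_factorial, mul_sum]
  exact sum_congr rfl fun w _ => by ring
end

section
/- Let d ≥ 1 be an integer, t > −1 a real number, and j ≥ 0 an integer. Then for every x ∈ ℝ^d, the j-fold Laplacian of the Gaussian satisfies Δ^j ( e^{−|x|²/(1+t)} ) = ((−1)^j j! 4^j / (1+t)^j) e^{−|x|²/(1+t)} L_j^{(d/2 − 1)}( |x|²/(1+t) ). -/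
open MeasureTheory Real Finset

/-- The Laplace operator `Δf = Σ_i ∂²f/∂x_i²` on functions of `d` real variables. -/
noncomputable def lap (d : ℕ) (f : (Fin d → ℝ) → ℝ) (x : Fin d → ℝ) : ℝ :=
  ∑ i : Fin d, iteratedDeriv 2 (fun s => f (Function.update x i s)) (x i)

/-- The Laplacian of a radial function `x ↦ g (|x|²)`. -/
lemma lap_comp_sum_sq (d : ℕ) {g g' g'' : ℝ → ℝ} (hg : ∀ r, HasDerivAt g (g' r) r)
    (hg' : ∀ r, HasDerivAt g' (g'' r) r) (x : Fin d → ℝ) :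
    lap d (fun x => g (∑ i, (x i) ^ 2)) x
      = 2 * d * g' (∑ i, (x i) ^ 2) + 4 * (∑ i, (x i) ^ 2) * g'' (∑ i, (x i) ^ 2) := by
  have key : ∀ i : Fin d,
      iteratedDeriv 2 (fun s => g (∑ k, (Function.update x i s k) ^ 2)) (x i)
        = 2 * g' (∑ k, (x k) ^ 2) + 4 * (x i) ^ 2 * g'' (∑ k, (x k) ^ 2) := by
    intro i
    set c : ℝ := ∑ k ∈ univ.erase i, (x k) ^ 2
    have hupd : ∀ s, ∑ k, (Function.update x i s k) ^ 2 = s ^ 2 + c := by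
      intro s
      rw [← Finset.add_sum_erase _ _ (mem_univ i), Function.update_self]
      congr 1
      refine Finset.sum_congr rfl fun k hk => ?_
      rw [Function.update_of_ne (Finset.ne_of_mem_erase hk)]
    have hx : ∑ k, (x k) ^ 2 = (x i) ^ 2 + c :=
      (Finset.add_sum_erase _ (fun k => (x k) ^ 2) (mem_univ i)).symm
    have hsq : ∀ s : ℝ, HasDerivAt (fun s : ℝ => s ^ 2 + c) (2 * s) s := fun s => by
      simpa using (hasDerivAt_pow 2 s).add_const c
    have hd1 : deriv (fun s => g (s ^ 2 + c)) = fun s => g' (s ^ 2 + c) * (2 * s) :=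
      funext fun s => ((hg (s ^ 2 + c)).comp s (hsq s)).deriv
    have hd2 : HasDerivAt (fun s => g' (s ^ 2 + c) * (2 * s))
        (g'' ((x i) ^ 2 + c) * (2 * x i) * (2 * x i) + g' ((x i) ^ 2 + c) * (2 * 1)) (x i) :=
      ((hg' ((x i) ^ 2 + c)).comp (x i) (hsq (x i))).mul ((hasDerivAt_id (x i)).const_mul 2)
    simp only [hupd, hx]
    rw [iteratedDeriv_succ, iteratedDeriv_one, hd1, hd2.deriv]
    ring
  unfold lap
  simp only [key, sum_add_distrib, ← sum_mul, ← mul_sum, sum_const, card_univ, Fintype.card_fin,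
    nsmul_eq_mul]
  ring

/-- Conjugating `y ∂² + g ∂` by `exp (-y)`: the operator `e^y (y ∂² + g ∂) e^{-y}` on polynomials. -/
noncomputable def gaussLap (g : ℝ) (p : Polynomial ℝ) : Polynomial ℝ :=
  Polynomial.X * (p.derivative.derivative - 2 * p.derivative + p)
    + Polynomial.C g * (p.derivative - p)

lemma gaussLap_C_mul (g c : ℝ) (p : Polynomial ℝ) :
    gaussLap g (Polynomial.C c * p) = Polynomial.C c * gaussLap g p := by
  simp only [gaussLap, Polynomial.derivative_C_mul]
  ring

lemma lap_exp_mul_eval (d : ℕ) {a : ℝ} (ha : a ≠ 0) (p : Polynomial ℝ) :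
    lap d (fun x => exp (-(∑ i, (x i) ^ 2) / a) * p.eval ((∑ i, (x i) ^ 2) / a))
      = fun x => exp (-(∑ i, (x i) ^ 2) / a) *
          (Polynomial.C (4 / a) * gaussLap (d / 2) p).eval ((∑ i, (x i) ^ 2) / a) := by
  have H : ∀ (q : Polynomial ℝ) (r : ℝ), HasDerivAt (fun r => exp (-r / a) * q.eval (r / a))
      (exp (-r / a) * (Polynomial.C a⁻¹ * (q.derivative - q)).eval (r / a)) r := by
    intro q r
    have h1 : HasDerivAt (fun r => exp (-r / a)) (exp (-r / a) * (-1 / a)) r :=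
      (((hasDerivAt_id r).neg).div_const a).exp
    have h2 : HasDerivAt (fun r => q.eval (r / a)) (q.derivative.eval (r / a) * (1 / a)) r :=
      HasDerivAt.comp (h := fun r => r / a) r (q.hasDerivAt (r / a))
        ((hasDerivAt_id r).div_const a)
    refine (h1.mul h2).congr_deriv ?_
    simp only [Polynomial.eval_mul, Polynomial.eval_C, Polynomial.eval_sub]
    ring
  funext x
  rw [lap_comp_sum_sq d (H p) (H _)]
  simp only [gaussLap, Polynomial.eval_mul, Polynomial.eval_C, Polynomial.eval_sub,
    Polynomial.eval_add, Polynomial.eval_X, Polynomial.derivative_mul, Polynomial.derivative_C,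
    Polynomial.derivative_sub, Polynomial.eval_ofNat, Polynomial.eval_zero]
  field_simp
  ring

/-- The polynomial `k! L_k^{(g - 1)}`. -/
noncomputable def lagPoly (g : ℝ) (k : ℕ) : Polynomial ℝ :=
  ∑ i ∈ range (k + 1),
    Polynomial.monomial i ((-1) ^ i * (k.choose i : ℝ) * (Gamma (k + g) / Gamma (i + g)))

lemma coeff_lagPoly (g : ℝ) (k i : ℕ) : (lagPoly g k).coeff i
    = (-1) ^ i * (k.choose i : ℝ) * (Gamma (k + g) / Gamma (i + g)) := by
  simp only [lagPoly, Polynomial.finsetSum_coeff, Polynomial.coeff_monomial, Finset.sum_ite_eq',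
    mem_range]
  split_ifs with h
  · rfl
  · rw [Nat.choose_eq_zero_of_lt (by omega)]
    simp

lemma lagPoly_zero {g : ℝ} (hg : 0 < g) : lagPoly g 0 = 1 := by
  simp [lagPoly, (Gamma_pos_of_pos hg).ne']

lemma eval_lagPoly (γ : ℝ) (k : ℕ) (y : ℝ) :
    (lagPoly (γ + 1) k).eval y = k.factorial * lag k γ y := by
  simp only [lagPoly, lag, Polynomial.eval_finsetSum, Polynomial.eval_monomial, Finset.mul_sum]
  refine Finset.sum_congr rfl fun i hi => ?_
  rw [Nat.cast_choose ℝ (by simpa [Nat.lt_succ_iff] using hi), ← add_assoc, ← add_assoc]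
  ring

lemma gaussLap_lagPoly {g : ℝ} (hg : 0 < g) (k : ℕ) :
    gaussLap g (lagPoly g k) = -lagPoly g (k + 1) := by
  have hpos : ∀ n : ℕ, 0 < (n : ℝ) + g := fun n => by positivity
  have hne : ∀ n : ℕ, Gamma ((n : ℝ) + g) ≠ 0 := fun n => (Gamma_pos_of_pos (hpos n)).ne'
  have hsucc : ∀ n : ℕ, Gamma ((n : ℝ) + 1 + g) = (n + g) * Gamma (n + g) := fun n => by
    rw [add_right_comm, Gamma_add_one (hpos n).ne']
  have hchoose : ∀ n : ℕ, (k.choose (n + 1) : ℝ) * (n + 1) = k.choose n * (k - n) := by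
    intro n
    rcases le_or_gt n k with h | h
    · rw [← Nat.cast_sub h]
      exact_mod_cast Nat.choose_succ_right_eq k n
    · simp [Nat.choose_eq_zero_of_lt h, Nat.choose_eq_zero_of_lt (h.trans n.lt_succ_self)]
  have h2 : (2 : Polynomial ℝ) = Polynomial.C 2 := rfl
  ext i
  rcases i with _ | i
  · have h0 : Gamma (1 + g) = g * Gamma g := by simpa using hsucc 0
    have hc : (k.choose 1 : ℝ) = k := by simp
    have hg0 : Gamma g ≠ 0 := (Gamma_pos_of_pos hg).ne'
    simp only [gaussLap, h2, Polynomial.coeff_add, Polynomial.coeff_X_mul_zero,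
      Polynomial.coeff_C_mul, Polynomial.coeff_sub, Polynomial.coeff_derivative,
      Polynomial.coeff_neg, coeff_lagPoly, Nat.choose_zero_right, Nat.cast_zero, Nat.cast_succ,
      zero_add, hsucc, h0, hc]
    field_simp
    ring
  · have hc := hchoose i
    have hc' := hchoose (i + 1)
    have hg1 := hne i
    have hi := (hpos i).ne'
    have hi' := (hpos (i + 1)).ne'
    have hsucc2 := hsucc (i + 1)
    simp only [gaussLap, h2, Polynomial.coeff_add, Polynomial.coeff_X_mul,
      Polynomial.coeff_C_mul, Polynomial.coeff_sub, Polynomial.coeff_derivative,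
      Polynomial.coeff_neg, coeff_lagPoly, Nat.choose_succ_succ' k i]
    push_cast at hc hc' hi hi' hsucc2 ⊢
    rw [hsucc2, hsucc i, hsucc k]
    field_simp
    linear_combination (hc' + hc) * ((-1) ^ i * (i + 1 + g))

/-- the `j`-fold Laplacian of a Gaussian. -/
theorem stmt15 (d : ℕ) (hd : 1 ≤ d) (t : ℝ) (ht : -1 < t) (j : ℕ) (x : Fin d → ℝ) :
    (lap d)^[j] (fun x => Real.exp (-(∑ i, (x i) ^ 2) / (1 + t))) x
    = ((-1 : ℝ) ^ j * (j.factorial : ℝ) * 4 ^ j / (1 + t) ^ j) *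
        Real.exp (-(∑ i, (x i) ^ 2) / (1 + t)) *
        lag j ((d : ℝ) / 2 - 1) ((∑ i, (x i) ^ 2) / (1 + t)) := by
  have ha : 1 + t ≠ 0 := by linarith
  have hg : (0 : ℝ) < d / 2 := by positivity
  have key : (lap d)^[j] (fun x => exp (-(∑ i, (x i) ^ 2) / (1 + t)))
      = fun x => exp (-(∑ i, (x i) ^ 2) / (1 + t)) *
          (Polynomial.C ((-(4 / (1 + t))) ^ j) * lagPoly (d / 2) j).eval
            ((∑ i, (x i) ^ 2) / (1 + t)) := by
    induction j with
    | zero => simp [lagPoly_zero hg]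
    | succ j ih =>
      rw [Function.iterate_succ_apply', ih, lap_exp_mul_eval d ha, gaussLap_C_mul,
        gaussLap_lagPoly hg]
      funext x
      simp only [Polynomial.eval_mul, Polynomial.eval_C, Polynomial.eval_neg]
      ring
  have hL := eval_lagPoly ((d : ℝ) / 2 - 1) j ((∑ i, (x i) ^ 2) / (1 + t))
  rw [sub_add_cancel] at hL
  rw [key]
  simp only [Polynomial.eval_mul, Polynomial.eval_C, hL]
  rw [neg_pow, div_pow]
  ring
end

section
/- Let n ≥ 1 and M ≥ 1 be integers. Then the generating function η_{2M} satisfies the moment conditions of order 2M: for every multi-index α with |α| < 2M, ∫_{ℝⁿ} η_{2M}(x) x^α dx equals 1 if α = 0 and equals 0 if 0 < |α| < 2M. -/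
open MeasureTheory Real Finset

/-- The generating function `η_{2M}` on `ℝⁿ`. -/
noncomputable def eta (n M : ℕ) (x : EuclideanSpace ℝ (Fin n)) : ℝ :=
  Real.pi ^ (-(n : ℝ) / 2) * lag (M - 1) ((n : ℝ) / 2) (‖x‖ ^ 2) * Real.exp (-‖x‖ ^ 2)

/-- The Chu–Vandermonde identity for rising factorials. -/
theorem sum_neg_one_pow_choose_mul_ascPochhammer (k : ℕ) (a c : ℝ) :
    ∑ i ∈ range (k + 1), (-1 : ℝ) ^ i * (k.choose i : ℝ) * (ascPochhammer ℝ i).eval a *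
      (ascPochhammer ℝ (k - i)).eval (c + i) = (ascPochhammer ℝ k).eval (c - a) := by
  induction k generalizing a c with
  | zero => simp
  | succ k ih =>
    have hleft : ∑ i ∈ range (k + 2), (-1 : ℝ) ^ i * (k.choose i : ℝ) *
        (ascPochhammer ℝ i).eval a * (ascPochhammer ℝ (k + 1 - i)).eval (c + i)
        = (c + k) * (ascPochhammer ℝ k).eval (c - a) := by
      rw [sum_range_succ, Nat.choose_succ_self, ← ih a c, mul_sum]
      simp only [Nat.cast_zero, mul_zero, zero_mul, add_zero]
      refine sum_congr rfl fun i hi => ?_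
      have hik : i ≤ k := Nat.lt_succ_iff.mp (mem_range.mp hi)
      rw [Nat.succ_sub hik, ascPochhammer_succ_eval, Nat.cast_sub hik]
      ring
    have hright : ∑ i ∈ range (k + 1), (-1 : ℝ) ^ (i + 1) * (k.choose i : ℝ) *
        (ascPochhammer ℝ (i + 1)).eval a * (ascPochhammer ℝ (k - i)).eval (c + (i + 1))
        = -(a * (ascPochhammer ℝ k).eval (c - a)) := by
      have h := ih (a + 1) (c + 1)
      rw [add_sub_add_right_eq_sub] at h
      rw [← h, mul_sum, ← sum_neg_distrib]
      refine sum_congr rfl fun i _ => ?_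
      rw [ascPochhammer_succ_left]
      simp only [Polynomial.eval_mul, Polynomial.eval_X, Polynomial.eval_comp,
        Polynomial.eval_add, Polynomial.eval_one]
      rw [show c + 1 + (i : ℝ) = c + (i + 1) by ring]
      ring
    have hsplit : ∑ i ∈ range (k + 2), (-1 : ℝ) ^ i * ((k + 1).choose i : ℝ) *
        (ascPochhammer ℝ i).eval a * (ascPochhammer ℝ (k + 1 - i)).eval (c + i)
        = (c + k) * (ascPochhammer ℝ k).eval (c - a)
          + -(a * (ascPochhammer ℝ k).eval (c - a)) := by
      rw [← hleft, ← hright, sum_range_succ', sum_range_succ' _ (k + 1), add_right_comm,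
        ← sum_add_distrib]
      congr 1
      · refine sum_congr rfl fun i _ => ?_
        rw [Nat.choose_succ_succ, Nat.add_sub_add_right]
        push_cast
        ring
      · simp
    rw [hsplit, ascPochhammer_succ_eval]
    ring

theorem Gamma_add_natCast_eq_ascPochhammer_mul {a : ℝ} (ha : 0 < a) (n : ℕ) :
    Real.Gamma (a + n) = (ascPochhammer ℝ n).eval a * Real.Gamma a := by
  induction n with
  | zero => simp
  | succ n ih =>
    rw [Nat.cast_succ, ← add_assoc, Real.Gamma_add_one (by positivity), ih,
      ascPochhammer_succ_eval]
    ring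

/-- Evaluating a Laguerre polynomial on the umbral powers `y ^ i ↦ (s)_i`. -/
theorem lag_umbral (k : ℕ) {γ : ℝ} (hγ : 0 ≤ γ) (s : ℝ) :
    ∑ i ∈ range (k + 1), (-1 : ℝ) ^ i * (Real.Gamma ((k : ℝ) + γ + 1) /
      (Real.Gamma ((i : ℝ) + γ + 1) * ((k - i).factorial : ℝ))) *
        (ascPochhammer ℝ i).eval s / (i.factorial : ℝ)
      = (ascPochhammer ℝ k).eval (γ + 1 - s) / k.factorial := by
  rw [← sum_neg_one_pow_choose_mul_ascPochhammer, sum_div]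
  refine sum_congr rfl fun i hi => ?_
  have hik : i ≤ k := Nat.lt_succ_iff.mp (mem_range.mp hi)
  have hpos : 0 < γ + 1 + i := by positivity
  have hG : Real.Gamma ((k : ℝ) + γ + 1)
      = (ascPochhammer ℝ (k - i)).eval (γ + 1 + i) * Real.Gamma ((i : ℝ) + γ + 1) := by
    rw [show (i : ℝ) + γ + 1 = γ + 1 + i by ring,
      ← Gamma_add_natCast_eq_ascPochhammer_mul hpos, Nat.cast_sub hik]
    congr 1
    ring
  have hΓ : Real.Gamma ((i : ℝ) + γ + 1) ≠ 0 := (Real.Gamma_pos_of_pos (by positivity)).ne'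
  rw [hG, Nat.cast_choose ℝ hik]
  have h1 : (i.factorial : ℝ) ≠ 0 := by positivity
  have h2 : ((k - i).factorial : ℝ) ≠ 0 := by positivity
  have h3 : (k.factorial : ℝ) ≠ 0 := by positivity
  field_simp

theorem integrable_pow_mul_exp_neg_sq (m : ℕ) :
    Integrable fun x : ℝ => x ^ m * Real.exp (-x ^ 2) := by
  have h := integrable_rpow_mul_exp_neg_mul_sq one_pos (s := (m : ℝ))
    (by have : (0 : ℝ) ≤ m := m.cast_nonneg
        linarith)
  simpa [Real.rpow_natCast] using h

theorem integral_pow_add_two_mul_exp_neg_sq (m : ℕ) :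
    ∫ x : ℝ, x ^ (m + 2) * Real.exp (-x ^ 2)
      = ((m : ℝ) + 1) / 2 * ∫ x : ℝ, x ^ m * Real.exp (-x ^ 2) := by
  have hm := (integrable_pow_mul_exp_neg_sq m).const_mul ((m : ℝ) + 1)
  have hm2 := (integrable_pow_mul_exp_neg_sq (m + 2)).const_mul 2
  have h := integral_eq_zero_of_hasDerivAt_of_integrable
    (f := fun x : ℝ => x ^ (m + 1) * Real.exp (-x ^ 2))
    (fun x => by
      convert! (hasDerivAt_pow (m + 1) x).mul ((hasDerivAt_pow 2 x).neg.exp) using 1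
      simp only [Pi.sub_apply, Pi.neg_apply, Nat.add_sub_cancel]
      push_cast
      ring) (hm.sub hm2) (integrable_pow_mul_exp_neg_sq (m + 1))
  simp only [Pi.sub_apply] at h
  rw [integral_sub hm hm2, integral_const_mul, integral_const_mul] at h
  linarith

theorem integral_pow_mul_exp_neg_sq_of_odd {m : ℕ} (hm : Odd m) :
    ∫ x : ℝ, x ^ m * Real.exp (-x ^ 2) = 0 := by
  have h := integral_neg_eq_self (fun x : ℝ => x ^ m * Real.exp (-x ^ 2)) volume
  simp only [hm.neg_pow, neg_sq, neg_mul, integral_neg] at h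
  linarith

section GaussianMoments

variable {ι : Type*} [Fintype ι]

theorem prod_pow_add_single_two_mul [DecidableEq ι] (α : ι → ℕ) (j : ι) (f : ι → ℕ → ℝ) (r : ℝ)
    (hf : f j (α j + 2) = r * f j (α j)) :
    ∏ i, f i ((α + Pi.single j 2 : ι → ℕ) i) = r * ∏ i, f i (α i) := by
  rw [← mul_prod_erase univ _ (mem_univ j), ← mul_prod_erase univ (fun i => f i (α i)) (mem_univ j),
    ← mul_assoc, ← hf]
  congr 1
  · simp
  · refine prod_congr rfl fun i hi => ?_
    simp [Pi.single_eq_of_ne (ne_of_mem_erase hi)]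

theorem sum_sq_mul_monomial_mul_exp [DecidableEq ι] (i : ℕ) (α : ι → ℕ) (y : ι → ℝ) :
    (∑ j, y j ^ 2) ^ (i + 1) * ∏ j, (y j ^ α j * Real.exp (-y j ^ 2))
      = ∑ j, (∑ l, y l ^ 2) ^ i *
          ∏ l, (y l ^ (α + Pi.single j 2 : ι → ℕ) l * Real.exp (-y l ^ 2)) := by
  rw [pow_succ, mul_assoc, sum_mul, mul_sum]
  refine sum_congr rfl fun j _ => ?_
  rw [prod_pow_add_single_two_mul α j (fun l m => y l ^ m * Real.exp (-y l ^ 2)) (y j ^ 2) (by ring)]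

theorem integrable_sum_sq_pow_mul_monomial_mul_exp (i : ℕ) (α : ι → ℕ) :
    Integrable fun y : ι → ℝ =>
      (∑ j, y j ^ 2) ^ i * ∏ j, (y j ^ α j * Real.exp (-y j ^ 2)) := by
  classical
  induction i generalizing α with
  | zero =>
    simp only [pow_zero, one_mul]
    exact Integrable.fintype_prod fun j => integrable_pow_mul_exp_neg_sq (α j)
  | succ i ih =>
    simp only [sum_sq_mul_monomial_mul_exp]
    exact integrable_finsetSum _ fun j _ => ih _

theorem integral_sum_sq_pow_mul_monomial_mul_exp (i : ℕ) (α : ι → ℕ) :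
    ∫ y : ι → ℝ, (∑ j, y j ^ 2) ^ i * ∏ j, (y j ^ α j * Real.exp (-y j ^ 2))
      = (ascPochhammer ℝ i).eval ((∑ j, (α j : ℝ) + Fintype.card ι) / 2) *
        ∏ j, ∫ x : ℝ, x ^ α j * Real.exp (-x ^ 2) := by
  classical
  induction i generalizing α with
  | zero =>
    simp only [pow_zero, one_mul, ascPochhammer_zero, Polynomial.eval_one]
    exact integral_fintype_prod_volume_eq_prod fun j (x : ℝ) => x ^ α j * Real.exp (-x ^ 2)
  | succ i ih =>
    simp only [sum_sq_mul_monomial_mul_exp]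
    rw [integral_finsetSum _ fun j _ => integrable_sum_sq_pow_mul_monomial_mul_exp i _]
    have hstep (j : ι) : ∑ l, (((α + Pi.single j 2 : ι → ℕ) l : ℕ) : ℝ) = ∑ l, (α l : ℝ) + 2 := by
      rw [← Nat.cast_sum, ← Nat.cast_sum]
      simp [sum_add_distrib]
    simp only [ih, hstep]
    rw [← mul_sum]
    have hprod (j : ι) := prod_pow_add_single_two_mul α j
      (fun _ m => ∫ x : ℝ, x ^ m * Real.exp (-x ^ 2)) (((α j : ℝ) + 1) / 2)
      (integral_pow_add_two_mul_exp_neg_sq (α j))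
    simp only [hprod]
    rw [← sum_mul, ← sum_div, sum_add_distrib, ascPochhammer_succ_left]
    simp only [sum_const, card_univ, nsmul_eq_mul, mul_one, Polynomial.eval_mul,
      Polynomial.eval_X, Polynomial.eval_comp, Polynomial.eval_add, Polynomial.eval_one]
    rw [show (∑ l, (α l : ℝ) + 2 + Fintype.card ι) / 2
      = (∑ l, (α l : ℝ) + Fintype.card ι) / 2 + 1 by ring]
    ring

/-- A Laguerre polynomial in `|y|²` integrated against a monomial times a Gaussian. -/
theorem integral_lag_sum_sq_mul_monomial_mul_exp (k : ℕ) {γ : ℝ} (hγ : 0 ≤ γ) (α : ι → ℕ) :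
    ∫ y : ι → ℝ, lag k γ (∑ j, y j ^ 2) * ∏ j, (y j ^ α j * Real.exp (-y j ^ 2))
      = (ascPochhammer ℝ k).eval (γ + 1 - (∑ j, (α j : ℝ) + Fintype.card ι) / 2) / k.factorial *
        ∏ j, ∫ x : ℝ, x ^ α j * Real.exp (-x ^ 2) := by
  rw [← lag_umbral k hγ, sum_mul]
  simp only [lag, sum_mul]
  have hterm (i : ℕ) (y : ι → ℝ) : (-1 : ℝ) ^ i * (Real.Gamma ((k : ℝ) + γ + 1) /
      (Real.Gamma ((i : ℝ) + γ + 1) * ((k - i).factorial : ℝ))) * (∑ j, y j ^ 2) ^ i /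
        (i.factorial : ℝ) * ∏ j, (y j ^ α j * Real.exp (-y j ^ 2))
      = (-1 : ℝ) ^ i * (Real.Gamma ((k : ℝ) + γ + 1) /
      (Real.Gamma ((i : ℝ) + γ + 1) * ((k - i).factorial : ℝ))) / (i.factorial : ℝ) *
        ((∑ j, y j ^ 2) ^ i * ∏ j, (y j ^ α j * Real.exp (-y j ^ 2))) := by
    ring
  simp only [hterm]
  rw [integral_finsetSum _ fun i _ =>
    (integrable_sum_sq_pow_mul_monomial_mul_exp i α).const_mul _]
  refine sum_congr rfl fun i _ => ?_
  rw [integral_const_mul, integral_sum_sq_pow_mul_monomial_mul_exp]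
  ring

end GaussianMoments

/-- `η_{2M}` satisfies the moment conditions of order `2M`. -/
theorem stmt16 (n M : ℕ) (hn : 1 ≤ n) (hM : 1 ≤ M) (α : Fin n → ℕ)
    (hα : ∑ i, α i < 2 * M) :
    (∫ x : EuclideanSpace ℝ (Fin n), eta n M x * ∏ i, (x i) ^ (α i))
    = if α = 0 then 1 else 0 := by
  have hcoord : (∫ x : EuclideanSpace ℝ (Fin n), eta n M x * ∏ i, (x i) ^ (α i))
      = Real.pi ^ (-(n : ℝ) / 2) * ∫ y : Fin n → ℝ, lag (M - 1) ((n : ℝ) / 2) (∑ j, y j ^ 2) *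
          ∏ j, (y j ^ α j * Real.exp (-y j ^ 2)) := by
    rw [← (PiLp.volume_preserving_toLp (Fin n)).integral_comp
      (MeasurableEquiv.toLp 2 _).measurableEmbedding, ← integral_const_mul]
    refine integral_congr_ae (ae_of_all _ fun y => ?_)
    simp only [eta, EuclideanSpace.real_norm_sq_eq, prod_mul_distrib, ← Real.exp_sum,
      sum_neg_distrib]
    ring
  rw [hcoord, integral_lag_sum_sq_mul_monomial_mul_exp _ (by positivity), Fintype.card_fin]
  split_ifs with h0
  · subst h0
    have hg : ∫ x : ℝ, Real.exp (-x ^ 2) = Real.pi ^ (1 / 2 : ℝ) := by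
      simpa [Real.sqrt_eq_rpow] using integral_gaussian 1
    have harg : (n : ℝ) / 2 + 1 - (∑ j : Fin n, (((0 : Fin n → ℕ) j : ℕ) : ℝ) + n) / 2 = 1 := by
      simp
    rw [harg, ascPochhammer_eval_one, div_self (by positivity), one_mul]
    simp only [Pi.zero_apply, pow_zero, one_mul, hg, prod_const, card_univ, Fintype.card_fin]
    rw [← Real.rpow_natCast, ← Real.rpow_mul Real.pi_pos.le, ← Real.rpow_add Real.pi_pos]
    convert Real.rpow_zero _ using 2
    ring
  · by_cases hodd : ∃ j, Odd (α j)
    · obtain ⟨j, hj⟩ := hodd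
      rw [prod_eq_zero (mem_univ j) (integral_pow_mul_exp_neg_sq_of_odd hj)]
      simp
    · push Not at hodd
      obtain ⟨m, hm⟩ : 2 ∣ ∑ j, α j := dvd_sum fun j _ => (Nat.not_odd_iff_even.mp (hodd j)).two_dvd
      have hm0 : m ≠ 0 := by
        rintro rfl
        exact h0 (funext fun j => by simpa using (sum_eq_zero_iff.mp hm) j (mem_univ j))
      have harg : (n : ℝ) / 2 + 1 - (∑ j, (α j : ℝ) + n) / 2 = -((m - 1 : ℕ) : ℝ) := by
        rw [← Nat.cast_sum, hm, Nat.cast_sub (Nat.one_le_iff_ne_zero.mpr hm0)]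
        push_cast
        ring
      rw [harg, ascPochhammer_eval_neg_coe_nat_of_lt (by omega)]
      simp
end
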